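/- Let K be a number field, Galois over ℚ, with Gal(K/ℚ) isomorphic to the symmetric group S₃, such that K contains a square root of −6 and every rational prime ramified in K lies in {2, 3}. Then K is isomorphic to the splitting field over ℚ of the polynomial X³ + 3X − 2. In other words, the splitting field of X³ + 3X − 2 is the unique S₃-extension of ℚ containing ℚ(√-6) and unramified outside {2,3}. -/

import Mathlib

open Polynomial

/-- If `θ` is a root of an integral cubic `X³ - P X - Q` that is Eisenstein at `ℓ`, then `ℓ`
divides the discriminant. -/
theorem prime_dvd_discr_of_eisenstein_cubic {K : Type*} [Field K] [NumberField K] {ℓ : ℤ}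
    (hℓ : Prime ℓ) {P Q : ℤ} {θ : K} (hθ : θ ^ 3 = P * θ + Q) (hP : ℓ ∣ P) (hQ : ℓ ∣ Q)
    (hQ2 : ¬ ℓ ^ 2 ∣ Q) : ℓ ∣ NumberField.discr K := by
  by_contra hd
  rw [NumberField.not_dvd_discr_iff_forall_mem K (NumberField.RingOfIntegers K) hℓ] at hd
  have hint : IsIntegral ℤ θ := by
    refine ⟨X ^ 3 - (C P * X + C Q), ?_, ?_⟩
    · apply monic_X_pow_sub
      compute_degree!
    · simp only [eval₂_sub, eval₂_add, eval₂_mul, eval₂_pow, eval₂_X, eval₂_C, hθ]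
      simp
  obtain ⟨t, rfl⟩ : ∃ t : NumberField.RingOfIntegers K, (t : K) = θ := ⟨⟨θ, hint⟩, rfl⟩
  have ht : t ^ 3 = P * t + Q := by
    apply NumberField.RingOfIntegers.ext
    simpa using hθ
  have hmax : (Ideal.span {ℓ}).IsMaximal := by
    have := (Ideal.span_singleton_prime hℓ.ne_zero).2 hℓ
    exact this.isMaximal (by simpa using hℓ.ne_zero)
  obtain ⟨I, hI, hIℓ⟩ := Ideal.exists_maximal_ideal_liesOver_of_isIntegral
    (S := NumberField.RingOfIntegers K) (Ideal.span {ℓ})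
  have hI' := hI.isPrime
  have hmem : ∀ n : ℤ, (n : NumberField.RingOfIntegers K) ∈ I ↔ ℓ ∣ n := fun n ↦ by
    rw [← Ideal.mem_span_singleton, hIℓ.over, Ideal.mem_comap]
    simp
  have hunr := hd I hI' ((hmem ℓ).2 dvd_rfl)
  rw [← not_dvd_differentIdeal_iff] at hunr
  apply hunr
  have htI : t ∈ I := by
    apply hI'.mem_of_pow_mem 3
    rw [ht]
    exact I.add_mem (I.mul_mem_right _ ((hmem P).2 hP)) ((hmem Q).2 hQ)
  have hQI : (Q : NumberField.RingOfIntegers K) ∈ I ^ 2 := by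
    have : (Q : NumberField.RingOfIntegers K) = t ^ 2 * t - P * t := by linear_combination -ht
    rw [this]
    refine sub_mem (Ideal.mul_mem_right _ _ (Ideal.pow_mem_pow htI 2)) ?_
    rw [pow_two]
    exact Ideal.mul_mem_mul ((hmem P).2 hP) htI
  obtain ⟨q, rfl⟩ := hQ
  have hq : ¬ ℓ ∣ q := fun h ↦ hQ2 (by rw [pow_two]; exact mul_dvd_mul_left _ h)
  obtain ⟨a, b, hab⟩ := (hℓ.coprime_iff_not_dvd).2 hq
  have hI2 : (ℓ : NumberField.RingOfIntegers K) ∈ I ^ 2 := by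
    have h1 : (ℓ : NumberField.RingOfIntegers K) = a * (ℓ * ℓ) + b * (ℓ * q : ℤ) := by
      exact_mod_cast (by linear_combination -ℓ * hab : ℓ = a * (ℓ * ℓ) + b * (ℓ * q))
    rw [h1]
    refine add_mem (Ideal.mul_mem_left _ _ ?_) (Ideal.mul_mem_left _ _ hQI)
    rw [pow_two]
    exact Ideal.mul_mem_mul ((hmem ℓ).2 dvd_rfl) ((hmem ℓ).2 dvd_rfl)
  simpa using pow_sub_one_dvd_differentIdeal ℤ (p := Ideal.span {ℓ}) I 2
    (by simpa using hℓ.ne_zero) (by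
      rw [Ideal.dvd_iff_le, Ideal.map_span, Ideal.span_le]
      simpa using hI2)

namespace Zsqrtd

theorem norm_two_eq (z : ℤ√2) : z.norm = z.re ^ 2 - 2 * z.im ^ 2 := by
  rw [norm_def]; ring

theorem norm_two_eq_zero_iff (z : ℤ√2) : z.norm = 0 ↔ z = 0 :=
  norm_eq_zero (fun n h ↦ by
    have h1 : n < 2 := by nlinarith
    have h2 : -2 < n := by nlinarith
    interval_cases n <;> omega) z

/-- The quotient map rounding both coordinates of the exact quotient. -/
def divTwo (x y : ℤ√2) : ℤ√2 :=
  ⟨round (((x * star y).re : ℚ) / y.norm), round (((x * star y).im : ℚ) / y.norm)⟩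

theorem natAbs_norm_sub_mul_divTwo_lt (x : ℤ√2) {y : ℤ√2} (hy : y ≠ 0) :
    (x - y * divTwo x y).norm.natAbs < y.norm.natAbs := by
  have hN : y.norm ≠ 0 := mt (norm_two_eq_zero_iff y).1 hy
  have hNQ : (y.norm : ℚ) ≠ 0 := by exact_mod_cast hN
  set a : ℚ := ((x * star y).re : ℚ) / y.norm with ha
  set b : ℚ := ((x * star y).im : ℚ) / y.norm with hb
  have h1 := abs_le.1 (abs_sub_round a)
  have h2 := abs_le.1 (abs_sub_round b)
  have hdiv : divTwo x y = ⟨round a, round b⟩ := rfl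
  rw [hdiv]
  clear hdiv
  set e := a - round a with he
  set f := b - round b with hf
  have key : ((x - y * ⟨round a, round b⟩).norm : ℚ) = y.norm * (e ^ 2 - 2 * f ^ 2) := by
    have hx : (x.re : ℚ) = y.re * a + 2 * y.im * b := by
      rw [ha, hb, ← mul_right_inj' hNQ]
      field_simp
      simp [norm_two_eq]
      ring
    have hx' : (x.im : ℚ) = y.re * b + y.im * a := by
      rw [ha, hb, ← mul_right_inj' hNQ]
      field_simp
      simp [norm_two_eq]
      ring
    simp only [norm_two_eq, re_sub, im_sub, re_mul, im_mul]
    clear_value a b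
    push_cast
    rw [hx, hx', he, hf]
    ring
  zify
  have : |((x - y * ⟨round a, round b⟩).norm : ℚ)| < |(y.norm : ℚ)| := by
    rw [key, abs_mul]
    refine mul_lt_of_lt_one_right (abs_pos.2 hNQ) (abs_lt.2 ⟨?_, ?_⟩) <;> nlinarith
  exact_mod_cast this

/-- `ℤ[√2]` is norm-Euclidean. -/
noncomputable instance euclideanDomainTwo : EuclideanDomain (ℤ√2) :=
  { Zsqrtd.commRing, Zsqrtd.nontrivial with
    quotient := divTwo
    remainder := fun x y ↦ x - y * divTwo x y
    quotient_zero := fun x ↦ by simp [divTwo]; rfl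
    quotient_mul_add_remainder_eq := fun _ _ ↦ by ring
    r := _
    r_wellFounded := (measure (Int.natAbs ∘ norm)).wf
    remainder_lt := fun x _ hy ↦ natAbs_norm_sub_mul_divTwo_lt x hy
    mul_left_not_lt := fun a b hb ↦ not_lt_of_ge <| by
      change a.norm.natAbs ≤ (a * b).norm.natAbs
      rw [norm_mul, Int.natAbs_mul]
      exact le_mul_of_one_le_right (Nat.zero_le _)
        (Int.natAbs_pos.2 (mt (norm_two_eq_zero_iff b).1 hb)) }

theorem exists_pow_dvd_of_pow_dvd_norm {ℓ : ℕ} (hℓ : ℓ.Prime) (hℓ2 : ℓ ≠ 2) {γ : ℤ√2} {k : ℕ}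
    (hk : k ≠ 0) (hγ : ¬ (ℓ : ℤ√2) ∣ γ) (hN : (ℓ : ℤ) ^ k ∣ γ.norm) :
    ∃ g : ℤ√2, ¬ IsUnit g ∧ g ∣ ℓ ∧ g ^ k ∣ γ := by
  have hℓZ : Prime (ℓ : ℤ) := Nat.prime_iff_prime_int.1 hℓ
  have hunit : ¬ IsUnit (ℓ : ℤ√2) := fun h ↦ by
    have := (norm_eq_one_iff.2 h)
    rw [norm_natCast, Int.natAbs_mul, Int.natAbs_natCast] at this
    exact hℓ.one_lt.ne' (Nat.eq_one_of_mul_eq_one_right this)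
  obtain ⟨π, hπirr, hπℓ⟩ := WfDvdMonoid.exists_irreducible_factor hunit
    (Nat.cast_ne_zero.2 hℓ.ne_zero)
  have hπ : Prime π := hπirr.prime
  have hπ' : Prime (star π) := by
    exact (MulEquiv.prime_iff (starRingAut (R := ℤ√2)).toMulEquiv (p := π)).2 hπ
  have hstar : ∀ {a b : ℤ√2}, a ∣ b → star a ∣ star b := fun {a b} h ↦ by
    exact map_dvd (starRingEnd (ℤ√2)) h
  have hπ'ℓ : star π ∣ (ℓ : ℤ√2) := by simpa using hstar hπℓ
  have hℓγ : (ℓ : ℤ√2) ^ k ∣ γ * star γ := by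
    rw [← norm_eq_mul_conj]
    exact_mod_cast (intCast_dvd_intCast (d := 2) _ _).2 hN
  obtain ⟨i, hi, hNπ⟩ : ∃ i ≤ 2, π.norm.natAbs = ℓ ^ i := by
    rw [← Nat.dvd_prime_pow hℓ]
    obtain ⟨δ, hδ⟩ := hπℓ
    refine ⟨δ.norm.natAbs, ?_⟩
    rw [← Int.natAbs_mul, ← norm_mul, ← hδ, norm_natCast, Int.natAbs_mul, Int.natAbs_natCast, sq]
  have hassoc : (Associated ((ℓ ^ i : ℕ) : ℤ√2) (π * star π)) := by
    rw [← norm_eq_mul_conj]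
    rcases Int.natAbs_eq π.norm with h | h <;> rw [h, hNπ]
    · simp
    · simp
  interval_cases i
  · exact absurd (norm_eq_one_iff.1 (by simpa using hNπ)) hπ.not_isUnit
  · rw [pow_one] at hassoc hNπ
    have hnot : ¬ (π ∣ γ ∧ star π ∣ γ) := by
      rintro ⟨⟨δ, rfl⟩, h⟩
      rcases hπ'.dvd_or_dvd h with h | h
      · have h2 : star π ∣ ((2 * π.re : ℤ) : ℤ√2) := by
          have : ((2 * π.re : ℤ) : ℤ√2) = π + star π := by
            ext <;> simp; ring
          rw [this]
          exact dvd_add h dvd_rfl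
        have h3 : (ℓ : ℤ) ∣ (2 * π.re) * (2 * π.re) := by
          obtain ⟨δ, hδ⟩ := h2
          rw [← norm_intCast (d := 2), hδ, norm_mul, norm_conj]
          exact Dvd.dvd.mul_right (Int.natCast_dvd.2 (by rw [hNπ])) _
        have h2' : ¬ (ℓ : ℤ) ∣ 2 := fun h ↦
          hℓ2 ((Nat.prime_dvd_prime_iff_eq hℓ Nat.prime_two).1 (by exact_mod_cast h))
        have h4 : (ℓ : ℤ) ∣ π.re :=
          (hℓZ.dvd_or_dvd ((hℓZ.dvd_or_dvd h3).elim id id)).resolve_left h2'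
        have hπN : (ℓ : ℤ) ∣ π.norm := Int.natCast_dvd.2 (by rw [hNπ])
        have h5 : (ℓ : ℤ) ∣ π.im := by
          rw [norm_two_eq, dvd_sub_right (dvd_pow h4 two_ne_zero)] at hπN
          exact hℓZ.dvd_of_dvd_pow ((hℓZ.dvd_or_dvd hπN).resolve_left h2')
        obtain ⟨a, ha⟩ := h4
        obtain ⟨b, hb⟩ := h5
        have h6 : ℓ * ℓ ∣ ℓ := by
          conv_rhs => rw [← hNπ]
          rw [← Int.natCast_dvd]
          exact ⟨a ^ 2 - 2 * b ^ 2, by rw [norm_two_eq, ha, hb]; push_cast; ring⟩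
        have := Nat.le_of_dvd hℓ.pos h6
        nlinarith [hℓ.two_le]
      · exact hγ (hassoc.dvd.trans (mul_dvd_mul_left _ h))
    by_cases h : π ∣ γ
    · have h' : ¬ star π ∣ γ := fun h' ↦ hnot ⟨h, h'⟩
      refine ⟨π, hπ.not_isUnit, hπℓ, ?_⟩
      have := hπ'.pow_dvd_of_dvd_mul_left k h' ((pow_dvd_pow_of_dvd hπ'ℓ k).trans hℓγ)
      simpa using hstar this
    · refine ⟨star π, hπ'.not_isUnit, hπ'ℓ, ?_⟩
      have := hπ.pow_dvd_of_dvd_mul_left k h ((pow_dvd_pow_of_dvd hπℓ k).trans hℓγ)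
      simpa using hstar this
  · exfalso
    obtain ⟨δ, hδ⟩ := hπℓ
    have hδu : IsUnit δ := by
      rw [← norm_eq_one_iff]
      have : ℓ ^ 2 * δ.norm.natAbs = ℓ ^ 2 := by
        rw [← hNπ, ← Int.natAbs_mul, ← norm_mul, ← hδ, norm_natCast, hNπ, Int.natAbs_mul,
          Int.natAbs_natCast, sq]
      exact (Nat.mul_eq_left (pow_ne_zero 2 hℓ.ne_zero)).1 this
    have hp : Prime (ℓ : ℤ√2) := by
      rw [hδ]
      exact (associated_mul_unit_right π δ hδu).prime hπ
    rcases hp.dvd_or_dvd ((dvd_pow_self _ hk).trans hℓγ) with h | h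
    · exact hγ h
    · exact hγ (by simpa using hstar h)

theorem eisenstein_of_cubeFree {α : ℤ√2} {m : ℤ} (hα : ∀ g : ℤ√2, g ^ 3 ∣ α → IsUnit g)
    (hm : α.norm = m ^ 3) {ℓ : ℕ} (hℓ : ℓ.Prime) (hℓm : (ℓ : ℤ) ∣ m) :
    ℓ ≠ 2 ∧ ℓ ≠ 3 ∧ (ℓ : ℤ) ∣ 2 * α.re ∧ ¬ (ℓ : ℤ) ^ 2 ∣ 2 * α.re := by
  have hℓZ : Prime (ℓ : ℤ) := Nat.prime_iff_prime_int.1 hℓ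
  have hℓ0 : (ℓ : ℤ) ≠ 0 := hℓZ.ne_zero
  obtain ⟨n, rfl⟩ := hℓm
  have hℓ2 : ℓ ≠ 2 := by
    rintro rfl
    rw [norm_two_eq] at hm
    obtain ⟨x, hx⟩ : (2 : ℤ) ∣ α.re := by
      apply Int.prime_two.dvd_of_dvd_pow (n := 2)
      exact ⟨α.im ^ 2 + 4 * n ^ 3, by push_cast at hm; linarith⟩
    obtain ⟨y, hy⟩ : (2 : ℤ) ∣ α.im := by
      apply Int.prime_two.dvd_of_dvd_pow (n := 2)
      exact ⟨x ^ 2 - 2 * n ^ 3, by push_cast at hm; rw [hx] at hm; linarith⟩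
    obtain ⟨z, hz⟩ : (2 : ℤ) ∣ x := by
      apply Int.prime_two.dvd_of_dvd_pow (n := 2)
      exact ⟨y ^ 2 + n ^ 3, by push_cast at hm; rw [hx, hy] at hm; linarith⟩
    have := hα sqrtd ⟨⟨y, z⟩, by
      rw [pow_succ, pow_two]
      ext <;> simp [hx, hy, hz]; ring⟩
    rw [← norm_eq_one_iff, norm_two_eq] at this
    simp at this
  have h2' : ¬ (ℓ : ℤ) ∣ 2 := fun h ↦
    hℓ2 ((Nat.prime_dvd_prime_iff_eq hℓ Nat.prime_two).1 (by exact_mod_cast h))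
  have hunit : ¬ IsUnit (ℓ : ℤ√2) := fun h ↦ by
    have := (norm_eq_one_iff.2 h)
    rw [norm_natCast, Int.natAbs_mul, Int.natAbs_natCast] at this
    exact hℓ.one_lt.ne' (Nat.eq_one_of_mul_eq_one_right this)
  have hdvd : (ℓ : ℤ√2) ∣ α := by
    by_contra h
    obtain ⟨g, hg, -, hgα⟩ := exists_pow_dvd_of_pow_dvd_norm hℓ hℓ2 three_ne_zero h
      ⟨n ^ 3, by rw [hm, mul_pow]⟩
    exact hg (hα g hgα)
  obtain ⟨β, rfl⟩ := hdvd
  rw [norm_mul, norm_natCast] at hm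
  have hNβ : β.norm = ℓ * n ^ 3 := by
    apply mul_left_cancel₀ (mul_ne_zero hℓ0 hℓ0)
    rw [hm]; ring
  have hdvd : ¬ (ℓ : ℤ√2) ∣ β := by
    rintro ⟨γ, rfl⟩
    have hNγ : (ℓ : ℤ) * γ.norm = n ^ 3 := by
      apply mul_left_cancel₀ hℓ0
      rw [← hNβ, norm_mul, norm_natCast]; ring
    obtain ⟨k, rfl⟩ : (ℓ : ℤ) ∣ n := hℓZ.dvd_of_dvd_pow ⟨_, hNγ.symm⟩
    have hγ : ¬ (ℓ : ℤ√2) ∣ γ := by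
      rintro ⟨δ, rfl⟩
      exact hunit (hα ℓ ⟨δ, by ring⟩)
    obtain ⟨g, hg, hgℓ, c, hc⟩ := exists_pow_dvd_of_pow_dvd_norm hℓ hℓ2 two_ne_zero hγ
      ⟨k ^ 3, by
        apply mul_left_cancel₀ hℓ0
        rw [hNγ]; ring⟩
    obtain ⟨d, hd⟩ := hgℓ
    exact hg (hα g ⟨d * ℓ * c, by rw [hc]; nth_rewrite 1 [hd]; ring⟩)
  have hre : ¬ (ℓ : ℤ) ∣ β.re := fun h ↦ by
    apply hdvd
    have him : (ℓ : ℤ) ∣ β.im := by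
      have hN : (ℓ : ℤ) ∣ β.norm := ⟨_, hNβ⟩
      rw [norm_two_eq, dvd_sub_right (dvd_pow h two_ne_zero)] at hN
      exact hℓZ.dvd_of_dvd_pow ((hℓZ.dvd_or_dvd hN).resolve_left h2')
    exact_mod_cast (intCast_dvd (d := 2) ℓ β).2 ⟨h, him⟩
  refine ⟨hℓ2, ?_, ⟨2 * β.re, by simp; ring⟩, ?_⟩
  · rintro rfl
    rw [norm_two_eq] at hNβ
    have h3 : ¬ (3 : ℤ) ∣ β.im := fun h ↦ hre <| by
      obtain ⟨b, hb⟩ := h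
      apply hℓZ.dvd_of_dvd_pow (n := 2)
      exact ⟨n ^ 3 + 6 * b ^ 2, by rw [hb] at hNβ; push_cast at hNβ ⊢; linarith⟩
    have h1 : (β.re ^ 2 - 2 * β.im ^ 2) % 3 = 0 := by rw [hNβ]; simp
    have h2 : β.re % 3 = 1 ∨ β.re % 3 = 2 := by push_cast at hre; omega
    have h4 : β.im % 3 = 1 ∨ β.im % 3 = 2 := by omega
    rcases h2 with h2 | h2 <;> rcases h4 with h4 | h4 <;>
      simp [Int.sub_emod, Int.mul_emod, pow_two, h2, h4] at h1
  · rintro ⟨c, hc⟩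
    have : (ℓ : ℤ) ∣ 2 * β.re := ⟨c, by
      apply mul_left_cancel₀ hℓ0
      simp at hc
      linarith⟩
    exact hre ((hℓZ.dvd_or_dvd this).resolve_left h2')

/-- Up to cubes, the only units of `ℤ[√2]` are `1`, `1 + √2` and `1 - √2`. -/
theorem exists_eq_mul_cube_of_norm_natAbs_eq_one (α : ℤ√2) (hα : α.norm.natAbs = 1) :
    ∃ c : ℤ√2, α = c ^ 3 ∨ α = ⟨1, 1⟩ * c ^ 3 ∨ α = ⟨1, -1⟩ * c ^ 3 := by
  obtain ⟨n, hn⟩ : ∃ n, α.im.natAbs = n := ⟨_, rfl⟩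
  induction n using Nat.strong_induction_on generalizing α with
  | _ n ih =>
  wlog hre : 0 ≤ α.re generalizing α
  · obtain ⟨c, hc⟩ := this (-α) (by simpa using hα) (by simpa using hn)
      (by simp only [re_neg]; omega)
    refine ⟨-c, ?_⟩
    have h3 : (-c) ^ 3 = -c ^ 3 := by ring
    rw [h3]
    rcases hc with hc | hc | hc
    · exact .inl (by rw [← hc, neg_neg])
    · exact .inr (.inl (by rw [mul_neg, ← hc, neg_neg]))
    · exact .inr (.inr (by rw [mul_neg, ← hc, neg_neg]))
  wlog him : 0 ≤ α.im generalizing α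
  · obtain ⟨c, hc⟩ := this (star α) (by simpa using hα) (by simpa using hn) (by simpa using hre)
      (by simp only [im_star]; omega)
    refine ⟨star c, ?_⟩
    have e1 : star (⟨1, 1⟩ : ℤ√2) = ⟨1, -1⟩ := rfl
    have e2 : star (⟨1, -1⟩ : ℤ√2) = ⟨1, 1⟩ := rfl
    rcases hc with hc | hc | hc <;> replace hc := congrArg star hc
    · exact .inl (by simpa using hc)
    · exact .inr (.inr (by simpa [e1, mul_comm] using hc))
    · exact .inr (.inl (by simpa [e2, mul_comm] using hc))
  have hN : α.re ^ 2 - 2 * α.im ^ 2 = 1 ∨ α.re ^ 2 - 2 * α.im ^ 2 = -1 := by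
    rw [← norm_two_eq]; omega
  rcases him.eq_or_lt with h0 | hpos
  · rw [← h0] at hN
    have : α.re = 1 := by
      rcases hN with h | h <;> nlinarith
    exact ⟨1, .inl (by ext <;> simp [this, ← h0])⟩
  · have h1 : α.im ≤ α.re := by rcases hN with h | h <;> nlinarith
    have h2 : α.re < 2 * α.im := by rcases hN with h | h <;> nlinarith
    have hαε : α = ⟨1, 1⟩ * ⟨2 * α.im - α.re, α.re - α.im⟩ := by
      ext <;> simp <;> ring
    obtain ⟨c, hc⟩ := ih (α.re - α.im).natAbs (by omega) ⟨2 * α.im - α.re, α.re - α.im⟩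
      (by
        rw [norm_two_eq]
        have : (2 * α.im - α.re) ^ 2 - 2 * (α.re - α.im) ^ 2 =
          -(α.re ^ 2 - 2 * α.im ^ 2) := by ring
        simp only [this]
        omega) rfl
    rcases hc with hc | hc | hc <;> rw [hc] at hαε
    · exact ⟨c, .inr (.inl hαε)⟩
    · refine ⟨-⟨1, 1⟩ * c, .inr (.inr ?_)⟩
      have : (⟨1, 1⟩ : ℤ√2) * ⟨1, 1⟩ = ⟨1, -1⟩ * (-⟨1, 1⟩) ^ 3 := by decide
      rw [hαε, mul_pow, ← mul_assoc, ← mul_assoc, this]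
    · refine ⟨-c, .inl ?_⟩
      have : (⟨1, 1⟩ : ℤ√2) * ⟨1, -1⟩ = -1 := by decide
      rw [hαε, ← mul_assoc, this]
      ring

end Zsqrtd

/-- `α ∈ ℤ[√2]` is the cube of `t + ζ √2` with `t, ζ ∈ K` of trace zero along the orbits of `σ` and
`t² - 2 ζ²` rational. -/
def IsTraceZeroCube {K : Type*} [Field K] [CharZero K] (σ : K ≃ₐ[ℚ] K) (α : ℤ√2) : Prop :=
  ∃ (t ζ : K) (M : ℚ), t + σ t + σ (σ t) = 0 ∧ ζ + σ ζ + σ (σ ζ) = 0 ∧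
    t ^ 3 + 6 * t * ζ ^ 2 = α.re ∧ 3 * t ^ 2 * ζ + 2 * ζ ^ 3 = α.im ∧ t ^ 2 - 2 * ζ ^ 2 = M

namespace IsTraceZeroCube

variable {K : Type*} [Field K] [CharZero K] {σ : K ≃ₐ[ℚ] K} {α β : ℤ√2}

theorem of_mul_cube {g : ℤ√2} (hg : g ≠ 0) (h : IsTraceZeroCube σ (g ^ 3 * β)) :
    IsTraceZeroCube σ β := by
  obtain ⟨t, ζ, M, ht, hζ, hre, him, hM⟩ := h
  have hN : (g.norm : K) ≠ 0 := by exact_mod_cast mt (Zsqrtd.norm_two_eq_zero_iff g).1 hg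
  have hN' : (g.norm : K) = g.re ^ 2 - 2 * g.im ^ 2 := by
    rw [Zsqrtd.norm_two_eq]; push_cast; ring
  have e1 : ((g ^ 3 * β).re : K) = (g.re ^ 3 + 6 * g.re * g.im ^ 2) * β.re +
      2 * (3 * g.re ^ 2 * g.im + 2 * g.im ^ 3) * β.im := by
    simp [pow_succ]; ring
  have e2 : ((g ^ 3 * β).im : K) = (g.re ^ 3 + 6 * g.re * g.im ^ 2) * β.im +
      (3 * g.re ^ 2 * g.im + 2 * g.im ^ 3) * β.re := by
    simp [pow_succ]; ring
  rw [e1] at hre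
  rw [e2] at him
  refine ⟨(t * g.re - 2 * ζ * g.im) / g.norm, (ζ * g.re - t * g.im) / g.norm, M / g.norm,
    ?_, ?_, ?_, ?_, ?_⟩
  · simp only [map_div₀, map_sub, map_mul, map_intCast, map_ofNat]
    field_simp
    linear_combination (g.re : K) * ht - 2 * g.im * hζ
  · simp only [map_div₀, map_sub, map_mul, map_intCast]
    field_simp
    linear_combination (g.re : K) * hζ - g.im * ht
  · field_simp
    rw [hN']
    linear_combination (g.re ^ 3 + 6 * g.re * g.im ^ 2 : K) * hre -
      2 * (3 * g.re ^ 2 * g.im + 2 * g.im ^ 3) * him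
  · field_simp
    rw [hN']
    linear_combination (g.re ^ 3 + 6 * g.re * g.im ^ 2 : K) * him -
      (3 * g.re ^ 2 * g.im + 2 * g.im ^ 3) * hre
  · push_cast
    field_simp
    rw [hN']
    linear_combination (g.re ^ 2 - 2 * g.im ^ 2 : K) * hM

theorem exists_norm_eq_cube (h : IsTraceZeroCube σ α) :
    ∃ m : ℤ, α.norm = m ^ 3 ∧ ∃ t : K, t + σ t + σ (σ t) = 0 ∧
      4 * t ^ 3 = 3 * m * t + α.re := by
  obtain ⟨t, ζ, M, ht, -, hre, him, hM⟩ := h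
  have hNM : (α.norm : ℚ) = M ^ 3 := by
    have : (α.norm : K) = (M : K) ^ 3 := by
      rw [Zsqrtd.norm_two_eq]
      push_cast
      rw [← hre, ← him, ← hM]
      ring
    exact_mod_cast this
  have hint : IsIntegral ℤ M := by
    apply IsIntegral.of_pow (n := 3) (by norm_num)
    rw [← hNM]
    exact isIntegral_algebraMap (R := ℤ) (A := ℚ) (x := α.norm)
  obtain ⟨m, rfl⟩ := IsIntegrallyClosed.isIntegral_iff.1 hint
  have hNm : (α.norm : ℚ) = ((m ^ 3 : ℤ) : ℚ) := by rw [hNM]; simp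
  refine ⟨m, by exact_mod_cast hNm, t, ht, ?_⟩
  have hM' : t ^ 2 - 2 * ζ ^ 2 = (m : K) := by simpa using hM
  linear_combination hre + 3 * t * hM'

theorem not_one : ¬ IsTraceZeroCube σ 1 := by
  intro h
  obtain ⟨m, hm, t, ht, h⟩ := h.exists_norm_eq_cube
  have : m = 1 := by
    have : (m - 1) * (m ^ 2 + m + 1) = 0 := by
      simp at hm; linear_combination -hm
    rcases mul_eq_zero.1 this with h | h
    · omega
    · nlinarith
  subst this
  have h' : (t - 1) * (2 * t + 1) ^ 2 = 0 := by
    simp at h; linear_combination h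
  rcases mul_eq_zero.1 h' with h | h
  · obtain rfl : t = 1 := by linear_combination h
    simp at ht
    norm_num at ht
  · obtain rfl : t = -(1 / 2) := by
      linear_combination (pow_eq_zero_iff two_ne_zero).1 h / 2
    simp only [map_neg, map_div₀, map_one, map_ofNat] at ht
    norm_num at ht

theorem exists_root (h : IsTraceZeroCube σ α) (hre : α.re = 1) (hN : α.norm = -1) :
    ∃ T : K, T ^ 3 + 3 * T - 2 = 0 := by
  obtain ⟨m, hm, t, -, h⟩ := h.exists_norm_eq_cube
  have : m = -1 := by
    have : (m + 1) * (m ^ 2 - m + 1) = 0 := by rw [hN] at hm; linear_combination -hm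
    rcases mul_eq_zero.1 this with h | h
    · omega
    · nlinarith
  subst this
  refine ⟨2 * t, ?_⟩
  rw [hre] at h
  push_cast at h
  linear_combination 2 * h

theorem exists_root_of_unramified {K : Type*} [Field K] [NumberField K] {σ : K ≃ₐ[ℚ] K}
    {α : ℤ√2} (h : IsTraceZeroCube σ α) (hα : α ≠ 0)
    (hram : ∀ p : ℕ, p.Prime → (p : ℤ) ∣ NumberField.discr K → p = 2 ∨ p = 3) :
    ∃ T : K, T ^ 3 + 3 * T - 2 = 0 := by
  obtain ⟨n, hn⟩ : ∃ n, α.norm.natAbs = n := ⟨_, rfl⟩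
  induction n using Nat.strong_induction_on generalizing α with
  | _ n ih =>
  by_cases hcf : ∀ g : ℤ√2, g ^ 3 ∣ α → IsUnit g
  · obtain ⟨m, hm, t, -, ht⟩ := h.exists_norm_eq_cube
    have hm1 : m.natAbs = 1 := by
      by_contra hm1
      obtain ⟨ℓ, hℓ, hℓm⟩ := Nat.exists_prime_and_dvd hm1
      rw [← Int.natCast_dvd] at hℓm
      obtain ⟨h2, h3, hre, hre2⟩ := Zsqrtd.eisenstein_of_cubeFree hcf hm hℓ hℓm
      have := prime_dvd_discr_of_eisenstein_cubic (θ := 2 * t) (Nat.prime_iff_prime_int.1 hℓ)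
        (P := 3 * m) (Q := 2 * α.re) (by push_cast; linear_combination 2 * ht)
        (hℓm.mul_left 3) hre hre2
      rcases hram ℓ hℓ this with h | h
      · exact h2 h
      · exact h3 h
    obtain ⟨c, hc⟩ := Zsqrtd.exists_eq_mul_cube_of_norm_natAbs_eq_one α
      (by rw [hm, Int.natAbs_pow, hm1, one_pow])
    have hc0 : c ≠ 0 := by
      rintro rfl
      simp [hα] at hc
    rcases hc with rfl | rfl | rfl
    · exact absurd (of_mul_cube hc0 (by rwa [mul_one])) not_one
    · rw [mul_comm] at h
      exact (of_mul_cube hc0 h).exists_root rfl (by simp [Zsqrtd.norm_two_eq])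
    · rw [mul_comm] at h
      exact (of_mul_cube hc0 h).exists_root rfl (by simp [Zsqrtd.norm_two_eq])
  · push Not at hcf
    obtain ⟨g, ⟨β, rfl⟩, hg⟩ := hcf
    have hg0 : g ≠ 0 := by
      rintro rfl
      simp at hα
    have hβ0 : β ≠ 0 := by
      rintro rfl
      simp at hα
    refine ih β.norm.natAbs ?_ (of_mul_cube hg0 h) hβ0 rfl
    rw [← hn, Zsqrtd.norm_mul, Int.natAbs_mul, pow_succ, Zsqrtd.norm_mul, Int.natAbs_mul]
    have h1 : 1 < g.norm.natAbs := by
      have h1 := mt Zsqrtd.norm_eq_one_iff.1 hg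
      have h2 := mt (Zsqrtd.norm_two_eq_zero_iff g).1 hg0
      omega
    have h2 : 0 < (g ^ 2).norm.natAbs :=
      Int.natAbs_pos.2 (mt (Zsqrtd.norm_two_eq_zero_iff _).1 (pow_ne_zero 2 hg0))
    have h3 : 0 < β.norm.natAbs := Int.natAbs_pos.2 (mt (Zsqrtd.norm_two_eq_zero_iff _).1 hβ0)
    exact lt_mul_of_one_lt_left h3 (by nlinarith)

/-- In an `S₃`-extension of `ℚ` containing `√-6`, multiplication by `√2` on the trace-zero elements
of a cubic subfield can be written as `t ↦ √-6 (σ t - σ² t) / 3`. -/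
theorem exists_of_gal_equiv_perm {K : Type*} [Field K] [NumberField K] [IsGalois ℚ K]
    (hgal : Nonempty ((K ≃ₐ[ℚ] K) ≃* Equiv.Perm (Fin 3))) (hsqrt : ∃ x : K, x ^ 2 = -6) :
    ∃ (σ : K ≃ₐ[ℚ] K) (α : ℤ√2), α ≠ 0 ∧ IsTraceZeroCube σ α := by
  obtain ⟨e⟩ := hgal
  obtain ⟨w, hw⟩ := hsqrt
  obtain ⟨c, s, hc1, hc, hs, hsc, hgen⟩ : ∃ c s : Equiv.Perm (Fin 3), c ≠ 1 ∧ c * (c * c) = 1 ∧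
      s * s = 1 ∧ s * c = c * (c * s) ∧
      ∀ g, g = 1 ∨ g = c ∨ g = c * c ∨ g = s ∨ g = c * s ∨ g = c * (c * s) := by
    refine ⟨finRotate 3, Equiv.swap 0 1, ?_⟩
    decide
  obtain ⟨σ, rfl⟩ := e.surjective c
  obtain ⟨τ, rfl⟩ := e.surjective s
  simp only [← map_mul, ← map_one e, e.injective.eq_iff, ne_eq] at hc1 hc hs hsc hgen
  replace hgen : ∀ g : K ≃ₐ[ℚ] K, g = 1 ∨ g = σ ∨ g = σ * σ ∨ g = τ ∨ g = σ * τ ∨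
      g = σ * (σ * τ) := fun g ↦ by
    simpa only [e.injective.eq_iff] using hgen (e g)
  have hσ : ∀ x, σ (σ (σ x)) = x := fun x ↦ DFunLike.congr_fun hc x
  have hτ : ∀ x, τ (τ x) = x := fun x ↦ DFunLike.congr_fun hs x
  have hτσ : ∀ x, τ (σ x) = σ (σ (τ x)) := fun x ↦ DFunLike.congr_fun hsc x
  have hfix : ∀ x, σ x = x → τ x = x → ∃ q : ℚ, x = q := fun x h1 h2 ↦ by
    obtain ⟨q, hq⟩ := (IsGalois.mem_range_algebraMap_iff_fixed (F := ℚ) x).2 fun g ↦ by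
      rcases hgen g with rfl | rfl | rfl | rfl | rfl | rfl <;> simp [h1, h2]
    exact ⟨q, by simpa using hq.symm⟩
  have hw0 : w ≠ 0 := by
    rintro rfl
    norm_num at hw
  have hpm : ∀ g : K ≃ₐ[ℚ] K, g w = w ∨ g w = -w := fun g ↦ by
    rw [← sq_eq_sq_iff_eq_or_eq_neg, ← map_pow, hw, map_neg, map_ofNat]
  have hσw : σ w = w := by
    refine (hpm σ).resolve_right fun h ↦ ?_
    have := hσ w
    simp only [h, map_neg, neg_neg] at this
    exact hw0 (self_eq_neg.1 this.symm)
  have hτw : τ w = -w := by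
    refine (hpm τ).resolve_left fun h ↦ ?_
    obtain ⟨q, rfl⟩ := hfix w hσw h
    have : q ^ 2 = -6 := by exact_mod_cast hw
    nlinarith
  obtain ⟨θ, hτθ, hσθ⟩ : ∃ θ, τ θ = θ ∧ σ θ ≠ θ := by
    by_contra! h
    apply hc1
    ext y
    obtain ⟨p, hp⟩ : ∃ q : ℚ, y + τ y = q := by
      have : τ (y + τ y) = y + τ y := by rw [map_add, hτ, add_comm]
      exact hfix _ (h _ this) this
    obtain ⟨q, hq⟩ : ∃ q : ℚ, w * (y - τ y) = q := by
      have : τ (w * (y - τ y)) = w * (y - τ y) := by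
        rw [map_mul, map_sub, hτ, hτw]; ring
      exact hfix _ (h _ this) this
    have hy : y = (p + q / w) / 2 := by
      rw [← hp, ← hq]; field_simp; ring
    rw [AlgEquiv.one_apply, hy]
    simp only [map_div₀, map_add, map_ratCast, map_ofNat, hσw]
  obtain ⟨t, ht0, htr, hτt⟩ : ∃ t, t ≠ 0 ∧ t + σ t + σ (σ t) = 0 ∧ τ t = t := by
    refine ⟨2 * θ - σ θ - σ (σ θ), fun h ↦ hσθ ?_, ?_, ?_⟩
    · have h' := congrArg σ h
      simp only [map_sub, map_mul, map_ofNat, map_zero, hσ] at h'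
      linear_combination (h' - h) / 3
    · simp only [map_sub, map_mul, map_ofNat, hσ]
      ring
    · simp only [map_sub, map_mul, map_ofNat, hτσ, hτθ, hσ]
      ring
  have hτa : τ (σ t) = σ (σ t) := by rw [hτσ, hτt]
  have hτb : τ (σ (σ t)) = σ t := by rw [hτσ, hτa, hσ]
  obtain ⟨ζ, hζ⟩ : ∃ ζ, ζ = w * (σ t - σ (σ t)) / 6 := ⟨_, rfl⟩
  have hσζ : σ ζ = w * (σ (σ t) - t) / 6 := by
    rw [hζ, map_div₀, map_mul, map_sub, hσw, hσ, map_ofNat]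
  have hτζ : τ ζ = ζ := by
    rw [hζ, map_div₀, map_mul, map_sub, hτw, hτa, hτb, map_ofNat]; ring
  have hζr : ζ + σ ζ + σ (σ ζ) = 0 := by
    rw [hσζ, hζ, map_div₀, map_mul, map_sub, hσw, hσ, map_ofNat]; ring
  have htr0 := htr
  obtain ⟨a, ha⟩ : ∃ a, a = σ t := ⟨_, rfl⟩
  obtain ⟨b, hb⟩ : ∃ b, b = σ a := ⟨_, rfl⟩
  simp only [← ha, ← hb] at htr hζ hσζ
  obtain rfl : b = -t - a := by linear_combination htr
  obtain ⟨M, hM⟩ : ∃ q : ℚ, t ^ 2 - 2 * ζ ^ 2 = q := by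
    apply hfix
    · simp only [map_sub, map_mul, map_pow, map_ofNat, ← ha, hσζ]
      rw [hζ]
      ring_nf
      simp only [hw]
      ring
    · simp only [map_sub, map_mul, map_pow, map_ofNat, hτζ, hτt]
  obtain ⟨x, hx⟩ : ∃ q : ℚ, t ^ 3 + 6 * t * ζ ^ 2 = q := by
    apply hfix
    · simp only [map_add, map_mul, map_pow, map_ofNat, ← ha, hσζ]
      rw [hζ]
      ring_nf
      simp only [hw]
      ring
    · simp only [map_add, map_mul, map_pow, map_ofNat, hτζ, hτt]
  obtain ⟨y, hy⟩ : ∃ q : ℚ, 3 * t ^ 2 * ζ + 2 * ζ ^ 3 = q := by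
    have hw3 : w ^ 3 = -6 * w := by rw [← hw]; ring
    apply hfix
    · simp only [map_add, map_mul, map_pow, map_ofNat, ← ha, hσζ]
      rw [hζ]
      ring_nf
      simp only [hw3]
      ring
    · simp only [map_add, map_mul, map_pow, map_ofNat, hτζ, hτt]
  obtain ⟨N, hN0, X, Y, hX, hY⟩ : ∃ N : ℤ, N ≠ 0 ∧ ∃ X Y : ℤ, N ^ 3 * x = X ∧ N ^ 3 * y = Y := by
    refine ⟨x.den * y.den, by simp, x.num * x.den ^ 2 * y.den ^ 3,
      y.num * y.den ^ 2 * x.den ^ 3, ?_, ?_⟩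
    · push_cast
      rw [← Rat.mul_den_eq_num]; ring
    · push_cast
      rw [← Rat.mul_den_eq_num]; ring
  have hXK : (N : K) ^ 3 * x = X := by exact_mod_cast congrArg (Rat.cast : ℚ → K) hX
  have hYK : (N : K) ^ 3 * y = Y := by exact_mod_cast congrArg (Rat.cast : ℚ → K) hY
  refine ⟨σ, ⟨X, Y⟩, ?_, N * t, N * ζ, N ^ 2 * M, ?_, ?_, ?_, ?_, ?_⟩
  · intro h
    obtain ⟨rfl, rfl⟩ : X = 0 ∧ Y = 0 := by simpa [Zsqrtd.ext_iff] using h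
    have hNK : (N : K) ≠ 0 := by exact_mod_cast hN0
    have hx0 : (x : K) = 0 := by simpa [hNK] using hXK
    have hy0 : (y : K) = 0 := by simpa [hNK] using hYK
    rw [hx0] at hx
    rw [hy0] at hy
    have h3 : (t ^ 2 - 2 * ζ ^ 2) ^ 3 = 0 := by
      linear_combination (t ^ 3 + 6 * t * ζ ^ 2) * hx - 2 * (3 * t ^ 2 * ζ + 2 * ζ ^ 3) * hy
    have h1 := (pow_eq_zero_iff three_ne_zero).1 h3
    have h4 : t ^ 3 = 0 := by linear_combination (hx + 3 * t * h1) / 4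
    exact ht0 ((pow_eq_zero_iff three_ne_zero).1 h4)
  · simp only [map_mul, map_intCast]
    linear_combination (N : K) * htr0
  · simp only [map_mul, map_intCast]
    linear_combination (N : K) * hζr
  · rw [← hXK, ← hx]; ring
  · rw [← hYK, ← hy]; ring
  · push_cast
    rw [← hM]; ring

end IsTraceZeroCube

theorem irreducible_X_pow_three_add_three_mul_X_sub_two :
    Irreducible (X ^ 3 + 3 * X - 2 : ℚ[X]) := by
  have hdeg : (X ^ 3 + 3 * X - 2 : ℚ[X]).natDegree = 3 := by compute_degree!
  rw [irreducible_iff_roots_eq_zero_of_degree_le_three (by rw [hdeg]; norm_num) hdeg.le,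
    Multiset.eq_zero_iff_forall_notMem]
  intro q hq
  have hq : q ^ 3 + 3 * q - 2 = 0 := by
    simpa [IsRoot] using isRoot_of_mem_roots hq
  have hint : IsIntegral ℤ q := by
    refine ⟨X ^ 3 + 3 * X - 2, by monicity!, ?_⟩
    rw [← hq]
    simp [eval₂_sub, eval₂_add, eval₂_mul]
  obtain ⟨n, rfl⟩ := IsIntegrallyClosed.isIntegral_iff.1 hint
  have hn : n ^ 3 + 3 * n - 2 = 0 := by
    simp only [eq_intCast] at hq
    exact_mod_cast hq
  have h0 : 0 < n := by nlinarith [sq_nonneg n]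
  have h1 : n < 1 := by nlinarith [sq_nonneg n]
  omega

theorem isSplittingField_of_root {K : Type*} [Field K] [NumberField K] [IsGalois ℚ K]
    (hK : Module.finrank ℚ K = 6) {T : K} (hT : T ^ 3 + 3 * T - 2 = 0) :
    IsSplittingField ℚ K (X ^ 3 + 3 * X - 2) := by
  have hmon : (X ^ 3 + 3 * X - 2 : ℚ[X]).Monic := by monicity!
  have hdeg : (X ^ 3 + 3 * X - 2 : ℚ[X]).natDegree = 3 := by compute_degree!
  have hmin : minpoly ℚ T = X ^ 3 + 3 * X - 2 :=
    (minpoly.eq_of_irreducible_of_monic irreducible_X_pow_three_add_three_mul_X_sub_two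
      (by simpa only [map_sub, map_add, map_mul, map_pow, aeval_X, map_ofNat] using hT) hmon).symm
  have hsplits : ((X ^ 3 + 3 * X - 2 : ℚ[X]).map (algebraMap ℚ K)).Splits := by
    rw [← hmin]
    exact Normal.splits inferInstance T
  refine ⟨hsplits, ?_⟩
  have hint (x : K) : IsIntegral ℚ x := Algebra.IsIntegral.isIntegral x
  set E := IntermediateField.adjoin ℚ ((X ^ 3 + 3 * X - 2 : ℚ[X]).rootSet K) with hE
  suffices hEtop : E = ⊤ by
    have := IntermediateField.adjoin_toSubalgebra_of_isAlgebraic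
      (F := ℚ) (S := (X ^ 3 + 3 * X - 2 : ℚ[X]).rootSet K) (fun x _ ↦ (hint x).isAlgebraic)
    rw [← this, ← hE, hEtop, IntermediateField.top_toSubalgebra]
  have hmem : ∀ x : K, x ^ 3 + 3 * x - 2 = 0 → x ∈ E := fun x hx ↦ by
    apply IntermediateField.subset_adjoin
    rw [mem_rootSet]
    exact ⟨hmon.ne_zero, by
      simpa only [map_sub, map_add, map_mul, map_pow, aeval_X, map_ofNat] using hx⟩
  have hdvd : ∀ x ∈ E, (minpoly ℚ x).natDegree ∣ Module.finrank ℚ E := fun x hx ↦ by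
    rw [← IntermediateField.minpoly_eq ⟨x, hx⟩]
    exact minpoly.degree_dvd (Algebra.IsIntegral.isIntegral _)
  have h3 : 3 ∣ Module.finrank ℚ E := by
    have := hdvd T (hmem T hT)
    rwa [hmin, hdeg] at this
  obtain ⟨S, hS⟩ : ∃ S : K, S ^ 2 + T * S + T ^ 2 + 3 = 0 := by
    have hfac : (X ^ 3 + 3 * X - 2 : ℚ[X]).map (algebraMap ℚ K) =
        (X ^ 2 + C T * X + C (T ^ 2 + 3)) * (X - C T) := by
      have hCT := congrArg (C : K → K[X]) hT
      simp only [Polynomial.map_sub, Polynomial.map_add, Polynomial.map_mul, Polynomial.map_pow,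
        map_X, Polynomial.map_ofNat]
      simp only [map_sub, map_add, map_mul, map_pow, map_ofNat, map_zero] at hCT ⊢
      linear_combination hCT
    have hdeg' : (X ^ 2 + C T * X + C (T ^ 2 + 3)).degree = 2 := by compute_degree!
    have hne : (X ^ 3 + 3 * X - 2 : ℚ[X]).map (algebraMap ℚ K) ≠ 0 := (hmon.map _).ne_zero
    obtain ⟨S, hS⟩ := (hsplits.of_dvd hne (hfac ▸ dvd_mul_right _ _)).exists_eval_eq_zero
      (by rw [hdeg']; exact two_ne_zero)
    refine ⟨S, ?_⟩
    simp only [eval_add, eval_mul, eval_pow, eval_X, eval_C] at hS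
    linear_combination hS
  have hδ : ((2 * S + T) * (3 * T ^ 2 + 3)) ^ 2 = -216 := by
    linear_combination 36 * (T ^ 2 + 1) ^ 2 * hS - 27 * (T ^ 3 + 3 * T + 2) * hT
  have h2 : 2 ∣ Module.finrank ℚ E := by
    set δ := (2 * S + T) * (3 * T ^ 2 + 3) with hδdef
    have hirr : Irreducible (X ^ 2 + C 216 : ℚ[X]) := by
      have hdeg : (X ^ 2 + C 216 : ℚ[X]).natDegree = 2 := by compute_degree!
      rw [irreducible_iff_roots_eq_zero_of_degree_le_three hdeg.ge (by rw [hdeg]; norm_num),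
        Multiset.eq_zero_iff_forall_notMem]
      intro q hq
      have hq : q ^ 2 + 216 = 0 := by simpa [IsRoot] using isRoot_of_mem_roots hq
      nlinarith
    have hmin2 : minpoly ℚ δ = X ^ 2 + C 216 :=
      (minpoly.eq_of_irreducible_of_monic hirr (by simp [hδ]) (by monicity!)).symm
    have hT' := hmem T hT
    have hS' := hmem S (by linear_combination (S - T) * hS + hT)
    have := hdvd δ (mul_mem (add_mem (mul_mem (ofNat_mem E 2) hS') hT')
      (add_mem (mul_mem (ofNat_mem E 3) (pow_mem hT' 2)) (ofNat_mem E 3)))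
    rwa [hmin2, natDegree_X_pow_add_C] at this
  have h6 : 6 ∣ Module.finrank ℚ E := (by norm_num : Nat.Coprime 2 3).mul_dvd_of_dvd_of_dvd h2 h3
  have hle : Module.finrank ℚ E ≤ 6 :=
    hK ▸ Submodule.finrank_le (Subalgebra.toSubmodule E.toSubalgebra)
  apply IntermediateField.eq_of_le_of_finrank_eq le_top
  rw [IntermediateField.finrank_top', hK]
  exact le_antisymm hle (Nat.le_of_dvd Module.finrank_pos h6)

/-- The splitting field of X³ + 3X − 2 is the unique S₃-extension of ℚ containing
ℚ(√-6) and unramified outside {2,3}. -/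
theorem stmt_10 (K : Type*) [Field K] [NumberField K] [IsGalois ℚ K]
    (hgal : Nonempty ((K ≃ₐ[ℚ] K) ≃* Equiv.Perm (Fin 3)))
    (hsqrt : ∃ x : K, x ^ 2 = -6)
    (hram : ∀ p : ℕ, p.Prime → (p : ℤ) ∣ NumberField.discr K → p = 2 ∨ p = 3) :
    Polynomial.IsSplittingField ℚ K (X ^ 3 + 3 * X - 2) := by
  have hK : Module.finrank ℚ K = 6 := by
    rw [← IsGalois.card_aut_eq_finrank, Nat.card_congr hgal.some.toEquiv, Nat.card_perm,
      Nat.card_fin]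
    rfl
  obtain ⟨σ, α, hα, h⟩ := IsTraceZeroCube.exists_of_gal_equiv_perm hgal hsqrt
  obtain ⟨T, hT⟩ := h.exists_root_of_unramified hα hram
  exact isSplittingField_of_root hK hT
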